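/- (Inequality (p12) in the proof of Theorem B(a)) Let u be a weak stationary solution density and let U be an anti-Lyapunov function in 𝒰 with respect to ℒ with anti-Lyapunov constant γ > 0, essential lower bound ρ_m and essential upper bound ρ_M. Let H be an upper sandwich function for U. Suppose ρ_m < η* < η < ρ_M and ∇U(x) ≠ 0 for every x ∈ U^{-1}(η) ∪ U^{-1}(η*). Then γ · μ(Ω_η \ Ω_{η*}) ≤ H(η) · ∫_{U^{-1}(η)} u(x)/|∇U(x)| dℋ^{n−1}(x), where ℋ^{n−1} is the (n−1)-dimensional Hausdorff measure. -/

import Mathlib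

open MeasureTheory

noncomputable section

/-- Euclidean space ℝⁿ. -/
abbrev Eucl (n : ℕ) : Type := EuclideanSpace ℝ (Fin n)

/-- First-order partial derivative `∂ᵢ f`. -/
def pd {n : ℕ} (f : Eucl n → ℝ) (i : Fin n) (x : Eucl n) : ℝ :=
  fderiv ℝ f x (EuclideanSpace.single i 1)

/-- Second-order partial derivative `∂²ᵢⱼ f`. -/
def pd2 {n : ℕ} (f : Eucl n → ℝ) (i j : Fin n) (x : Eucl n) : ℝ :=
  fderiv ℝ (fun y => fderiv ℝ f y (EuclideanSpace.single j 1)) x (EuclideanSpace.single i 1)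

/-- The adjoint Fokker–Planck operator `ℒf = aⁱʲ ∂²ᵢⱼ f + Vⁱ ∂ᵢ f`. -/
def Lop {n : ℕ} (a : Eucl n → Matrix (Fin n) (Fin n) ℝ)
    (V : Eucl n → Fin n → ℝ) (f : Eucl n → ℝ) (x : Eucl n) : ℝ :=
  (∑ i, ∑ j, a x i j * pd2 f i j x) + ∑ i, V x i * pd f i x

/-- The quadratic form `⟨a(x) ∇f(x), ∇f(x)⟩ = ∑ᵢⱼ aⁱʲ ∂ᵢf ∂ⱼf`. -/
def aQuad {n : ℕ} (a : Eucl n → Matrix (Fin n) (Fin n) ℝ)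
    (f : Eucl n → ℝ) (x : Eucl n) : ℝ :=
  ∑ i, ∑ j, a x i j * pd f i x * pd f j x

open Metric Filter Topology Set
open scoped Convolution

lemma pd_contDiff {n : ℕ} {f : Eucl n → ℝ} {k l : WithTop ℕ∞} (hf : ContDiff ℝ k f)
    (hkl : l + 1 ≤ k) (i : Fin n) : ContDiff ℝ l (pd f i) :=
  (hf.fderiv_right hkl).clm_apply contDiff_const

lemma pd_hasCompactSupport {n : ℕ} {f : Eucl n → ℝ} (hf : HasCompactSupport f) (i : Fin n) :
    HasCompactSupport (pd f i) :=
  hf.fderiv_apply ℝ _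

lemma Lop_eq_zero_of_notMem_tsupport {n : ℕ} (a : Eucl n → Matrix (Fin n) (Fin n) ℝ)
    (V : Eucl n → Fin n → ℝ) {f : Eucl n → ℝ} {x : Eucl n} (hx : x ∉ tsupport f) :
    Lop a V f x = 0 := by
  have h0 : f =ᶠ[𝓝 x] fun _ => 0 := notMem_tsupport_iff_eventuallyEq.mp hx
  have h1 : fderiv ℝ f =ᶠ[𝓝 x] fun _ => 0 := by
    filter_upwards [h0.fderiv (𝕜 := ℝ)] with y hy
    simp [hy]
  have hp : ∀ i, pd f i x = 0 := fun i => by simp [pd, h1.eq_of_nhds]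
  have hp2 : ∀ i j, pd2 f i j x = 0 := fun i j => by
    have : (fun y => fderiv ℝ f y (EuclideanSpace.single j 1)) =ᶠ[𝓝 x] fun _ => (0 : ℝ) := by
      filter_upwards [h1] with y hy
      simp [hy]
    simp [pd2, this.fderiv_eq]
  simp [Lop, hp, hp2]

lemma pd_normed_convolution {n : ℕ} (φ : ContDiffBump (0 : Eucl n)) {g : Eucl n → ℝ}
    (hg : ContDiff ℝ 1 g) (hgc : HasCompactSupport g) (i : Fin n) :
    pd (φ.normed volume ⋆[ContinuousLinearMap.lsmul ℝ ℝ, volume] g) i =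
      φ.normed volume ⋆[ContinuousLinearMap.lsmul ℝ ℝ, volume] pd g i := by
  ext x
  have hφ : LocallyIntegrable (φ.normed volume) volume := φ.continuous_normed.locallyIntegrable
  rw [pd, (hgc.hasFDerivAt_convolution_right (ContinuousLinearMap.lsmul ℝ ℝ) hφ hg x).fderiv]
  have hex := (hgc.fderiv ℝ).convolutionExists_right
    (ContinuousLinearMap.precompR (Eucl n) (ContinuousLinearMap.lsmul ℝ ℝ)) hφ
    (hg.continuous_fderiv one_ne_zero) x
  rw [convolution, ContinuousLinearMap.integral_apply hex]
  simp [convolution, pd]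

lemma exists_forall_dist_normed_convolution_le {n : ℕ} {g : Eucl n → ℝ} (hg : Continuous g)
    (hgc : HasCompactSupport g) {ε : ℝ} (hε : 0 < ε) :
    ∃ δ > 0, ∀ φ : ContDiffBump (0 : Eucl n), φ.rOut ≤ δ → ∀ x,
      |g x - (φ.normed volume ⋆[ContinuousLinearMap.lsmul ℝ ℝ, volume] g) x| ≤ ε := by
  obtain ⟨δ, hδ, h⟩ := Metric.uniformContinuous_iff.mp
    (hgc.uniformContinuous_of_continuous hg) ε hε
  refine ⟨δ, hδ, fun φ hφ x => ?_⟩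
  have := φ.dist_normed_convolution_le (μ := volume) (x₀ := x) (ε := ε) hg.aestronglyMeasurable
    (fun y hy => (h ((mem_ball.mp hy).trans_le hφ)).le)
  rwa [abs_sub_comm, ← Real.dist_eq]

lemma continuousOn_Lop_mul {n : ℕ} {W : Set (Eucl n)}
    {a : Eucl n → Matrix (Fin n) (Fin n) ℝ} (ha : ∀ i j, ContinuousOn (fun x => a x i j) W)
    {V : Eucl n → Fin n → ℝ} (hV : ContinuousOn V W) {u : Eucl n → ℝ} (hu : ContinuousOn u W)
    {g : Eucl n → ℝ} (hg : ContDiff ℝ 2 g) : ContinuousOn (fun x => Lop a V g x * u x) W := by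
  have h1 : ∀ j, ContDiff ℝ 1 (pd g j) := fun j => pd_contDiff hg (by norm_num) j
  have h2 : ∀ i j, ContDiff ℝ 0 (pd (pd g j) i) := fun i j => pd_contDiff (h1 j) (by norm_num) i
  refine ContinuousOn.mul (ContinuousOn.add ?_ ?_) hu
  · exact continuousOn_finsetSum _ fun i _ => continuousOn_finsetSum _ fun j _ =>
      (ha i j).mul (h2 i j).continuous.continuousOn
  · exact continuousOn_finsetSum _ fun i _ =>
      (continuousOn_pi.mp hV i).mul (h1 i).continuous.continuousOn

/-- A stationary density annihilates `ℒf` for compactly supported `f` of class `C²`. -/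
lemma integral_Lop_mul_eq_zero_of_contDiff_two {n : ℕ} {𝒰 : Set (Eucl n)} (hUopen : IsOpen 𝒰)
    {a : Eucl n → Matrix (Fin n) (Fin n) ℝ} (ha : ∀ i j, ContinuousOn (fun x => a x i j) 𝒰)
    {V : Eucl n → Fin n → ℝ} (hV : ContinuousOn V 𝒰)
    {u : Eucl n → ℝ} (hu : ContinuousOn u 𝒰)
    (hu_stat : ∀ f : Eucl n → ℝ, ContDiff ℝ (⊤ : ℕ∞) f → HasCompactSupport f →
      tsupport f ⊆ 𝒰 → (∫ x in 𝒰, Lop a V f x * u x) = 0)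
    {f : Eucl n → ℝ} (hf : ContDiff ℝ 2 f) (hfc : HasCompactSupport f) (hfU : tsupport f ⊆ 𝒰) :
    ∫ x in 𝒰, Lop a V f x * u x = 0 := by
  obtain ⟨δ₀, hδ₀, hK⟩ := hfc.isCompact.exists_cthickening_subset_open hUopen hfU
  set K := cthickening δ₀ (tsupport f) with hKdef
  have hKc : IsCompact K := hfc.isCompact.cthickening
  have hV' : ∀ i, ContinuousOn (fun x => V x i) 𝒰 := fun i => (continuousOn_pi.mp hV) i
  set G : Eucl n → ℝ := fun x => ((∑ i, ∑ j, |a x i j|) + ∑ i, |V x i|) * |u x| with hG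
  have hGc : ContinuousOn G 𝒰 := by
    refine ContinuousOn.mul (ContinuousOn.add ?_ ?_) hu.abs
    · exact continuousOn_finsetSum _ fun i _ => continuousOn_finsetSum _ fun j _ => (ha i j).abs
    · exact continuousOn_finsetSum _ fun i _ => (hV' i).abs
  have hGi : IntegrableOn G K := (hGc.mono hK).integrableOn_compact hKc
  have hp1 : ∀ j, ContDiff ℝ 1 (pd f j) := fun j => pd_contDiff hf (by norm_num) j
  have hp1s : ∀ j, HasCompactSupport (pd f j) := fun j => pd_hasCompactSupport hfc j
  have hp2 : ∀ i j, ContDiff ℝ 0 (pd (pd f j) i) := fun i j => pd_contDiff (hp1 j) (by norm_num) i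
  have hp2s : ∀ i j, HasCompactSupport (pd (pd f j) i) := fun i j =>
    pd_hasCompactSupport (hp1s j) i
  have key : ∀ ε > 0, |∫ x in 𝒰, Lop a V f x * u x| ≤ ε * ∫ x in K, G x := by
    intro ε hε
    have e1 : ∀ j, ∃ δ > 0, ∀ φ : ContDiffBump (0 : Eucl n), φ.rOut ≤ δ → ∀ x,
      |pd f j x - (φ.normed volume ⋆[ContinuousLinearMap.lsmul ℝ ℝ, volume] pd f j) x| ≤ ε :=
      fun j => exists_forall_dist_normed_convolution_le (hp1 j).continuous (hp1s j) hε
    have e2 : ∀ i j, ∃ δ > 0, ∀ φ : ContDiffBump (0 : Eucl n), φ.rOut ≤ δ → ∀ x,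
      |pd (pd f j) i x -
        (φ.normed volume ⋆[ContinuousLinearMap.lsmul ℝ ℝ, volume] pd (pd f j) i) x| ≤ ε :=
      fun i j => exists_forall_dist_normed_convolution_le (hp2 i j).continuous (hp2s i j) hε
    choose d1 hd1 h1 using e1
    choose d2 hd2 h2 using e2
    have hev : ∀ᶠ r in 𝓝[>] (0 : ℝ), 0 < r ∧ r < δ₀ ∧ (∀ j, r < d1 j) ∧ ∀ i j, r < d2 i j := by
      refine eventually_mem_nhdsWithin.and ?_
      refine Filter.Eventually.filter_mono nhdsWithin_le_nhds ?_
      refine (eventually_lt_nhds hδ₀).and (.and ?_ ?_)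
      · exact eventually_all.mpr fun j => eventually_lt_nhds (hd1 j)
      · exact eventually_all.mpr fun i => eventually_all.mpr fun j => eventually_lt_nhds (hd2 i j)
    obtain ⟨r, hr0, hrδ, hr1, hr2⟩ := hev.exists
    let φ : ContDiffBump (0 : Eucl n) := ⟨r / 2, r, by positivity, by linarith⟩
    set F := φ.normed volume ⋆[ContinuousLinearMap.lsmul ℝ ℝ, volume] f with hF
    have hFs : ContDiff ℝ (⊤ : ℕ∞) F :=
      φ.hasCompactSupport_normed.contDiff_convolution_left _ φ.contDiff_normed
        hf.continuous.locallyIntegrable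
    have hFcs : HasCompactSupport F := φ.hasCompactSupport_normed.convolution _ hfc
    have hFK : tsupport F ⊆ K := by
      refine closure_minimal (fun x hx => ?_) isClosed_cthickening
      obtain ⟨y, hy, z, hz, rfl⟩ := support_convolution_subset _ hx
      rw [φ.support_normed_eq, mem_ball_zero_iff] at hy
      refine mem_cthickening_of_dist_le _ z δ₀ _ (subset_tsupport _ hz) ?_
      simpa using hy.le.trans hrδ.le
    have hpF : ∀ j, pd F j = φ.normed volume ⋆[ContinuousLinearMap.lsmul ℝ ℝ, volume] pd f j :=
      fun j => pd_normed_convolution φ (hf.of_le (by norm_num)) hfc j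
    have hpF2 : ∀ i j, pd2 F i j =
        φ.normed volume ⋆[ContinuousLinearMap.lsmul ℝ ℝ, volume] pd (pd f j) i := by
      intro i j
      change pd (pd F j) i = _
      rw [hpF, pd_normed_convolution φ (hp1 j) (hp1s j)]
    have hzero := hu_stat F hFs hFcs (hFK.trans hK)
    have hfK : tsupport f ⊆ K := self_subset_cthickening _
    have hres : ∀ g : Eucl n → ℝ, tsupport g ⊆ K →
        ∫ x in 𝒰, Lop a V g x * u x = ∫ x in K, Lop a V g x * u x := fun g hg =>
      setIntegral_eq_of_subset_of_forall_sdiff_eq_zero hUopen.measurableSet hK fun x hx => by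
        rw [Lop_eq_zero_of_notMem_tsupport a V (fun h => hx.2 (hg h)), zero_mul]
    have hint : ∀ g : Eucl n → ℝ, ContDiff ℝ 2 g →
        IntegrableOn (fun x => Lop a V g x * u x) K := fun g hg =>
      ((continuousOn_Lop_mul ha hV hu hg).mono hK).integrableOn_compact hKc
    have hdiff : ∫ x in 𝒰, Lop a V f x * u x =
        ∫ x in K, (Lop a V f x * u x - Lop a V F x * u x) := by
      rw [integral_sub (hint f hf) (hint F (contDiff_infty.mp hFs 2)),
        ← hres f hfK, ← hres F hFK, hzero, sub_zero]
    rw [hdiff, ← Real.norm_eq_abs, ← integral_const_mul]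
    refine norm_integral_le_of_norm_le (hGi.const_mul ε) (Eventually.of_forall fun x => ?_)
    have hLd : Lop a V f x - Lop a V F x =
        (∑ i, ∑ j, a x i j * (pd2 f i j x - pd2 F i j x)) +
          ∑ i, V x i * (pd f i x - pd F i x) := by
      simp only [Lop, mul_sub, Finset.sum_sub_distrib]
      ring
    rw [← sub_mul, norm_mul, Real.norm_eq_abs, Real.norm_eq_abs, hG]
    simp only
    rw [← mul_assoc]
    refine mul_le_mul_of_nonneg_right ?_ (abs_nonneg _)
    rw [hLd, mul_add, Finset.mul_sum, Finset.mul_sum]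
    refine (abs_add_le _ _).trans (add_le_add ?_ ?_)
    · refine (Finset.abs_sum_le_sum_abs _ _).trans (Finset.sum_le_sum fun i _ => ?_)
      rw [Finset.mul_sum]
      refine (Finset.abs_sum_le_sum_abs _ _).trans (Finset.sum_le_sum fun j _ => ?_)
      rw [abs_mul, mul_comm, hpF2]
      exact mul_le_mul_of_nonneg_right (h2 i j φ (hr2 i j).le x) (abs_nonneg _)
    · refine (Finset.abs_sum_le_sum_abs _ _).trans (Finset.sum_le_sum fun j _ => ?_)
      rw [abs_mul, mul_comm, hpF]
      exact mul_le_mul_of_nonneg_right (h1 j φ (hr1 j).le x) (abs_nonneg _)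
  have hlim : Tendsto (fun ε : ℝ => ε * ∫ x in K, G x) (𝓝[>] 0) (𝓝 0) := by
    have : Tendsto (fun ε : ℝ => ε * ∫ x in K, G x) (𝓝 0) (𝓝 (0 * ∫ x in K, G x)) :=
      tendsto_id.mul_const _
    rw [zero_mul] at this
    exact this.mono_left nhdsWithin_le_nhds
  have := ge_of_tendsto hlim (eventually_mem_nhdsWithin.mono fun ε hε => key ε hε)
  exact abs_nonpos_iff.mp this

/-- Orthonormal coordinates adapted to a unit vector `ν`: a measure preserving parametrization
`Ψ` by `ℝ × ℝᵐ`, the first coordinate running along `ν`, and the complementary projection `π`. -/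
lemma exists_adapted_coordinates {m : ℕ} (ν : Eucl (m + 1)) (hν : ‖ν‖ = 1) :
    ∃ (Ψ : ℝ × (Fin m → ℝ) → Eucl (m + 1)) (π : Eucl (m + 1) → Fin m → ℝ),
      MeasurePreserving Ψ volume volume ∧ Continuous Ψ ∧ LipschitzWith 1 π ∧
      (∀ t y, π (Ψ (t, y)) = y) ∧ (∀ t s y, Ψ (t + s, y) = Ψ (t, y) + s • ν) ∧
      ∀ x x', ‖x - x'‖ ≤ |inner ℝ ν (x - x')| + m * ‖π x - π x'‖ := by
  obtain ⟨b, hb⟩ := Orthonormal.exists_orthonormalBasis_extension_of_card_eq (𝕜 := ℝ)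
    (E := Eucl (m + 1)) (ι := Fin (m + 1)) (by simp) (v := fun _ => ν) (s := {0})
    ⟨fun i => by simpa using hν, fun i j hij => (hij (Subsingleton.elim i j)).elim⟩
  have hb0 : b 0 = ν := hb 0 rfl
  have hmp : MeasurePreserving
      (fun z : ℝ × (Fin m → ℝ) => (Fin.cons z.1 z.2 : Fin (m + 1) → ℝ)) volume volume := by
    have h := (volume_preserving_piFinSuccAbove (fun _ : Fin (m + 1) => ℝ) 0).symm
    have heq : (fun z : ℝ × (Fin m → ℝ) => (Fin.cons z.1 z.2 : Fin (m + 1) → ℝ)) =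
        (MeasurableEquiv.piFinSuccAbove (fun _ : Fin (m + 1) => ℝ) 0).symm := by
      funext z
      exact (Fin.insertNth_zero (α := fun _ => ℝ) z.1 z.2).symm
    rw [heq]
    exact h
  refine ⟨fun z => b.repr.symm (WithLp.toLp 2 (Fin.cons z.1 z.2 : Fin (m + 1) → ℝ)),
    fun x i => b.repr x i.succ, ?_, ?_, ?_, ?_, ?_, ?_⟩
  · exact b.measurePreserving_repr_symm.comp
      ((PiLp.volume_preserving_toLp (Fin (m + 1))).comp hmp)
  · refine b.repr.symm.continuous.comp ((PiLp.continuous_toLp 2 _).comp ?_)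
    exact continuous_pi fun i => Fin.cases (by simp only [Fin.cons_zero]; fun_prop)
      (fun j => by simp only [Fin.cons_succ]; fun_prop) i
  · refine LipschitzWith.of_dist_le_mul fun x x' => ?_
    rw [NNReal.coe_one, one_mul, dist_pi_le_iff dist_nonneg]
    intro i
    rw [← b.repr.dist_map x x', dist_eq_norm, dist_eq_norm]
    simpa using PiLp.norm_apply_le (b.repr x - b.repr x') i.succ
  · intro t y
    ext i
    simp
  · intro t s y
    apply b.repr.injective
    ext i
    rw [map_add, LinearIsometryEquiv.apply_symm_apply, LinearIsometryEquiv.apply_symm_apply,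
      map_smul, ← hb0, b.repr_self]
    refine Fin.cases ?_ (fun j => ?_) i <;> simp
  · intro x x'
    have hsum := b.sum_repr (x - x')
    rw [Fin.sum_univ_succ, b.repr_apply_apply, hb0] at hsum
    calc ‖x - x'‖ = ‖(inner ℝ ν (x - x')) • ν + ∑ i : Fin m, b.repr (x - x') i.succ • b i.succ‖ := by
          rw [hsum]
      _ ≤ ‖(inner ℝ ν (x - x')) • ν‖ + ∑ i : Fin m, ‖b.repr (x - x') i.succ • b i.succ‖ :=
          (norm_add_le _ _).trans (add_le_add le_rfl (norm_sum_le _ _))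
      _ ≤ |inner ℝ ν (x - x')| + ∑ _i : Fin m,
          ‖(fun i : Fin m => b.repr x i.succ) - fun i : Fin m => b.repr x' i.succ‖ := by
          refine add_le_add (by rw [norm_smul, hν, mul_one, Real.norm_eq_abs])
            (Finset.sum_le_sum fun i _ => ?_)
          rw [norm_smul, b.norm_eq_one, mul_one]
          simpa using norm_le_pi_norm
            ((fun i : Fin m => b.repr x i.succ) - fun i : Fin m => b.repr x' i.succ) i
      _ = _ := by simp

/-- A `1`-Lipschitz map injective on `S` transports integrals against Lebesgue measure on its
image to integrals against Hausdorff measure on `S`. -/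
lemma lintegral_image_le_lintegral_hausdorffMeasure {m : ℕ} {E : Type*} [MetricSpace E]
    [MeasurableSpace E] [BorelSpace E] {π : E → Fin m → ℝ} (hπ : LipschitzWith 1 π) {S : Set E}
    (hS : MeasurableSet S) {σ : (Fin m → ℝ) → E} (hσ : ∀ x ∈ S, σ (π x) = x)
    (F : E → ENNReal) :
    ∫⁻ y in π '' S, F (σ y) ≤ ∫⁻ x in S, F x ∂μH[m] := by
  have hle : (volume : Measure (Fin m → ℝ)).restrict (π '' S) ≤
      Measure.map π ((μH[m] : Measure E).restrict S) := by
    refine Measure.le_intro fun T hT _ => ?_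
    rw [Measure.map_apply hπ.continuous.measurable hT,
      Measure.restrict_apply (hπ.continuous.measurable hT), Measure.restrict_apply hT]
    have h1 : T ∩ π '' S = π '' (π ⁻¹' T ∩ S) := by
      rw [inter_comm, image_inter_preimage .. |>.symm, inter_comm]
    rw [h1, ← hausdorffMeasure_pi_real]
    simpa using (hπ.lipschitzOnWith (s := π ⁻¹' T ∩ S)).hausdorffMeasure_image_le
      (d := m) (Nat.cast_nonneg m)
  calc ∫⁻ y in π '' S, F (σ y) ≤ ∫⁻ y, F (σ y) ∂(Measure.map π ((μH[m] : Measure E).restrict S)) :=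
        lintegral_mono' hle le_rfl
    _ ≤ ∫⁻ x in S, F (σ (π x)) ∂μH[m] := lintegral_map_le _ _
    _ = ∫⁻ x in S, F x ∂μH[m] := setLIntegral_congr_fun hS fun x hx => by simp only [hσ x hx]

/-- If `U` is close to affine with gradient `c • ν` on a ball, its level sets there have finite
Hausdorff measure and thin slabs are controlled by integrals over the level set. -/
lemma hausdorffMeasure_lt_top_and_lintegral_slab_le {m : ℕ} {U : Eucl (m + 1) → ℝ}
    {p ν : Eucl (m + 1)} {r c κ η : ℝ} (hν : ‖ν‖ = 1) (hc : 0 < c) (hκ1 : κ < 1)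
    (hUc : ContinuousOn U (closedBall p r))
    (hU : ∀ x ∈ closedBall p r, ∀ x' ∈ closedBall p r,
      |U x - U x' - c * inner ℝ ν (x - x')| ≤ κ * c * ‖x - x'‖) :
    μH[m] {x ∈ closedBall p r | U x = η} < ⊤ ∧
    ∀ (f : Eucl (m + 1) → ℝ) (ε ω s : ℝ), Continuous f → 0 < ε →
      s = ε / ((1 - κ) * c) → (∀ x, f x ≠ 0 → closedBall x s ⊆ closedBall p r) →
      (∀ x x', dist x x' ≤ s → f x ≤ f x' + ω) →
      ∫⁻ x in {x ∈ closedBall p r | η ≤ U x ∧ U x ≤ η + ε}, ENNReal.ofReal (f x) ≤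
        ENNReal.ofReal s * ∫⁻ x in {x ∈ closedBall p r | U x = η},
          ENNReal.ofReal (f x + ω) ∂μH[m] := by
  obtain ⟨Ψ, π, hΨ, hΨc, hπ, hπΨ, hΨν, hn⟩ := exists_adapted_coordinates ν hν
  set S := {x ∈ closedBall p r | U x = η} with hSdef
  have hSc : IsCompact S := by
    have : IsClosed (closedBall p r ∩ U ⁻¹' {η}) :=
      hUc.preimage_isClosed_of_isClosed isClosed_closedBall isClosed_singleton
    exact (isCompact_closedBall p r).of_isClosed_subset this fun x hx => hx.1
  have hanti : ∀ x ∈ S, ∀ x' ∈ S, ‖x - x'‖ ≤ m / (1 - κ) * ‖π x - π x'‖ := by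
    intro x hx x' hx'
    have h1 := hU x hx.1 x' hx'.1
    rw [hx.2, hx'.2, sub_self, zero_sub, abs_neg, abs_mul, abs_of_pos hc, mul_comm κ, mul_assoc]
      at h1
    have h2 := le_of_mul_le_mul_left h1 hc
    have h3 := hn x x'
    have h1κ : 0 < 1 - κ := by linarith
    rw [div_mul_eq_mul_div, le_div_iff₀ h1κ]
    nlinarith
  have hinj : InjOn π S := fun x hx x' hx' h => by
    have := hanti x hx x' hx'
    rw [h, sub_self, norm_zero, mul_zero] at this
    exact sub_eq_zero.mp (norm_le_zero_iff.mp this)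
  set σ := Function.invFunOn π S with hσdef
  have hσ : ∀ x ∈ S, σ (π x) = x := fun x hx => hinj.leftInvOn_invFunOn hx
  refine ⟨?_, ?_⟩
  · have hK : 0 ≤ m / (1 - κ) := div_nonneg (Nat.cast_nonneg m) (by linarith)
    have hL : LipschitzOnWith ⟨m / (1 - κ), hK⟩ σ (π '' S) := by
      refine LipschitzOnWith.of_dist_le_mul ?_
      rintro _ ⟨x, hx, rfl⟩ _ ⟨x', hx', rfl⟩
      rw [hσ x hx, hσ x' hx', dist_eq_norm, dist_eq_norm]
      exact hanti x hx x' hx'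
    have himg : σ '' (π '' S) = S := by
      rw [image_image]
      exact (image_congr hσ).trans (image_id' S)
    have hle := hL.hausdorffMeasure_image_le (d := m) (Nat.cast_nonneg m)
    rw [himg] at hle
    refine hle.trans_lt (ENNReal.mul_lt_top ?_ ?_)
    · exact ENNReal.rpow_lt_top_of_nonneg (Nat.cast_nonneg m) ENNReal.coe_ne_top
    · have hv : (μH[m] : Measure (Fin m → ℝ)) = volume := by
        simpa using hausdorffMeasure_pi_real (ι := Fin m)
      rw [hv]
      exact (hSc.image hπ.continuous).measure_lt_top
  · intro f ε ω s hf hε hs hball hmod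
    have hκc : 0 < (1 - κ) * c := mul_pos (by linarith) hc
    have hs0 : 0 < s := hs ▸ div_pos hε hκc
    have hsε : (1 - κ) * c * s = ε := by rw [hs, mul_div_cancel₀ _ hκc.ne']
    have hmono : ∀ x ∈ closedBall p r, ∀ d : ℝ, 0 ≤ d → x + d • ν ∈ closedBall p r →
        U x + (1 - κ) * c * d ≤ U (x + d • ν) := by
      intro x hx d hd hxd
      have h := (abs_le.mp (hU _ hxd x hx)).1
      rw [add_sub_cancel_left, inner_smul_right, real_inner_self_eq_norm_sq, norm_smul, hν,
        Real.norm_eq_abs, abs_of_nonneg hd] at h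
      linarith
    set T := {x ∈ closedBall p r | η ≤ U x ∧ U x ≤ η + ε} with hTdef
    have hT : MeasurableSet T :=
      (hUc.preimage_isClosed_of_isClosed isClosed_closedBall
        (isClosed_Icc (a := η) (b := η + ε))).measurableSet
    have hFm : Measurable (T.indicator fun x => ENNReal.ofReal (f x)) :=
      (ENNReal.measurable_ofReal.comp hf.measurable).indicator hT
    have hslice : ∀ y : Fin m → ℝ,
        ∫⁻ t : ℝ, T.indicator (fun x => ENNReal.ofReal (f x)) (Ψ (t, y)) ≤
          (π '' S).indicator (fun y => ENNReal.ofReal s * ENNReal.ofReal (f (σ y) + ω)) y := by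
      intro y
      by_cases hne : ∃ t : ℝ, T.indicator (fun x => ENNReal.ofReal (f x)) (Ψ (t, y)) ≠ 0
      swap
      · push Not at hne
        simp [hne]
      obtain ⟨t, ht⟩ := hne
      have htT : Ψ (t, y) ∈ T := mem_of_indicator_ne_zero ht
      have hft : f (Ψ (t, y)) ≠ 0 := fun h => ht (by simp [indicator, h])
      obtain ⟨t₀, ht₀⟩ : ∃ t₀ : ℝ, Ψ (t₀, y) ∈ S := by
        have hin : ∀ t' ∈ Icc (t - s) t, Ψ (t', y) ∈ closedBall p r := by
          intro t' ht'
          apply hball _ hft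
          have : Ψ (t', y) = Ψ (t, y) + (t' - t) • ν := by rw [← hΨν]; congr 2; ring
          rw [mem_closedBall, this, dist_self_add_left, norm_smul, hν, mul_one, Real.norm_eq_abs,
            abs_le]
          constructor <;> linarith [ht'.1, ht'.2]
        have hcont : ContinuousOn (fun t' => U (Ψ (t', y))) (Icc (t - s) t) :=
          hUc.comp (hΨc.comp (by fun_prop : Continuous fun t' : ℝ => (t', y))).continuousOn hin
        have hlow : U (Ψ (t - s, y)) ≤ η := by
          have h1 : Ψ (t - s, y) + s • ν = Ψ (t, y) := by rw [← hΨν, sub_add_cancel]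
          have := hmono _ (hin (t - s) ⟨le_rfl, by linarith⟩) s hs0.le (by rw [h1]; exact htT.1)
          rw [h1, hsε] at this
          linarith [htT.2.2]
        obtain ⟨t₀, h1, h2⟩ := intermediate_value_Icc (by linarith) hcont ⟨hlow, htT.2.1⟩
        exact ⟨t₀, hin t₀ h1, h2⟩
      have hy : π (Ψ (t₀, y)) = y := hπΨ t₀ y
      have hyS : y ∈ π '' S := ⟨_, ht₀, hy⟩
      have hσy : σ y = Ψ (t₀, y) := by
        have := hσ _ ht₀
        rwa [hy] at this
      rw [indicator_of_mem hyS, hσy]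
      have hpt : ∀ t' : ℝ, T.indicator (fun x => ENNReal.ofReal (f x)) (Ψ (t', y)) ≤
          (Icc t₀ (t₀ + s)).indicator (fun _ => ENNReal.ofReal (f (Ψ (t₀, y)) + ω)) t' := by
        intro t'
        by_cases ht' : Ψ (t', y) ∈ T
        swap
        · simp [ht']
        have e1 : Ψ (t', y) = Ψ (t₀, y) + (t' - t₀) • ν := by rw [← hΨν]; congr 2; ring
        have e2 : Ψ (t₀, y) = Ψ (t', y) + (t₀ - t') • ν := by rw [← hΨν]; congr 2; ring
        have hge : t₀ ≤ t' := by
          by_contra! hlt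
          have := hmono _ ht'.1 (t₀ - t') (by linarith) (by rw [← e2]; exact ht₀.1)
          rw [← e2, ht₀.2] at this
          have h3 := mul_pos hκc (sub_pos.mpr hlt)
          linarith [ht'.2.1]
        have hle : t' - t₀ ≤ s := by
          have := hmono _ ht₀.1 (t' - t₀) (by linarith) (by rw [← e1]; exact ht'.1)
          rw [← e1, ht₀.2] at this
          have h4 : (1 - κ) * c * (t' - t₀) ≤ (1 - κ) * c * s := by
            rw [hsε]; linarith [ht'.2.2]
          exact le_of_mul_le_mul_left h4 hκc
        rw [indicator_of_mem ht', indicator_of_mem (show t' ∈ Icc t₀ (t₀ + s) from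
          ⟨hge, by linarith⟩)]
        refine ENNReal.ofReal_le_ofReal (hmod _ _ ?_)
        rw [e1, dist_self_add_left, norm_smul, hν, mul_one, Real.norm_eq_abs,
          abs_of_nonneg (by linarith)]
        exact hle
      refine (lintegral_mono hpt).trans (le_of_eq ?_)
      rw [lintegral_indicator measurableSet_Icc, setLIntegral_const, Real.volume_Icc,
        add_sub_cancel_left, mul_comm]
    calc ∫⁻ x in T, ENNReal.ofReal (f x)
        = ∫⁻ x, T.indicator (fun x => ENNReal.ofReal (f x)) x := (lintegral_indicator hT _).symm
      _ = ∫⁻ z, T.indicator (fun x => ENNReal.ofReal (f x)) (Ψ z) :=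
          (hΨ.lintegral_comp hFm).symm
      _ = ∫⁻ y, ∫⁻ t, T.indicator (fun x => ENNReal.ofReal (f x)) (Ψ (t, y)) := by
          rw [Measure.volume_eq_prod]
          exact lintegral_prod_symm _ (hFm.comp hΨc.measurable).aemeasurable
      _ ≤ ∫⁻ y, (π '' S).indicator
            (fun y => ENNReal.ofReal s * ENNReal.ofReal (f (σ y) + ω)) y := lintegral_mono hslice
      _ = ∫⁻ y in π '' S, ENNReal.ofReal s * ENNReal.ofReal (f (σ y) + ω) :=
          lintegral_indicator (hSc.image hπ.continuous).measurableSet _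
      _ = ENNReal.ofReal s * ∫⁻ y in π '' S, ENNReal.ofReal (f (σ y) + ω) :=
          lintegral_const_mul' _ _ ENNReal.ofReal_ne_top
      _ ≤ _ := mul_le_mul_right (lintegral_image_le_lintegral_hausdorffMeasure hπ
          hSc.measurableSet hσ fun x => ENNReal.ofReal (f x + ω)) _

lemma continuousOn_gradient {n : ℕ} {W : Set (Eucl n)} (hW : IsOpen W) {U : Eucl n → ℝ}
    (hU : ContDiffOn ℝ 1 U W) : ContinuousOn (gradient U) W :=
  (InnerProductSpace.toDual ℝ (Eucl n)).symm.continuous.comp_continuousOn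
    (hU.continuousOn_fderiv_of_isOpen hW le_rfl)

/-- Near a regular point of the level set `U = η`, thin slabs `η ≤ U ≤ η + ε` are controlled by
the surface integral over the level set. -/
lemma exists_closedBall_lintegral_slab_le {m : ℕ} {W : Set (Eucl (m + 1))} (hW : IsOpen W)
    {U : Eucl (m + 1) → ℝ} (hU : ContDiffOn ℝ 1 U W) {p : Eucl (m + 1)} (hp : p ∈ W)
    (hgp : gradient U p ≠ 0) {κ : ℝ} (hκ0 : 0 < κ) (hκ1 : κ < 1) (η : ℝ) :
    ∃ r > 0, closedBall p r ⊆ W ∧ μH[m] {x ∈ closedBall p r | U x = η} < ⊤ ∧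
      ∀ f : Eucl (m + 1) → ℝ, Continuous f → (∀ x, 0 ≤ f x) → HasCompactSupport f →
        tsupport f ⊆ ball p r → ∀ τ > 0, ∀ᶠ ε in 𝓝[>] (0 : ℝ),
        ∫⁻ x in {x ∈ closedBall p r | η ≤ U x ∧ U x ≤ η + ε}, ENNReal.ofReal (f x) ≤
          ENNReal.ofReal ε * (ENNReal.ofReal ((1 + κ) / (1 - κ)) *
            ∫⁻ x in {x ∈ closedBall p r | U x = η}, ENNReal.ofReal (f x / ‖gradient U x‖) ∂μH[m] +
            ENNReal.ofReal τ) := by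
  set c := ‖gradient U p‖ with hcdef
  have hc : 0 < c := norm_pos_iff.mpr hgp
  set ν := c⁻¹ • gradient U p with hνdef
  have hν : ‖ν‖ = 1 := by
    rw [hνdef, norm_smul, norm_inv, Real.norm_of_nonneg hc.le, ← hcdef, inv_mul_cancel₀ hc.ne']
  have hfd : ∀ v, fderiv ℝ U p v = c * inner ℝ ν v := by
    intro v
    rw [hνdef, real_inner_smul_left, ← mul_assoc, mul_inv_cancel₀ hc.ne', one_mul, gradient,
      InnerProductSpace.toDual_symm_apply]
  have hstrict : HasStrictFDerivAt U (fderiv ℝ U p) p :=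
    (hU.contDiffAt (hW.mem_nhds hp)).hasStrictFDerivAt one_ne_zero
  have hκc : 0 < κ * c := mul_pos hκ0 hc
  obtain ⟨s₀, hs₀, happ⟩ := hstrict.approximates_deriv_on_nhds (c := ⟨κ * c, hκc.le⟩)
    (Or.inr (NNReal.coe_pos.mp hκc))
  have hgc : ContinuousAt (gradient U) p :=
    (continuousOn_gradient hW hU).continuousAt (hW.mem_nhds hp)
  have hev : ∀ᶠ x in 𝓝 p, x ∈ s₀ ∧ x ∈ W ∧ ‖gradient U x‖ < (1 + κ) * c ∧ 0 < ‖gradient U x‖ := by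
    refine .and hs₀ (.and (hW.mem_nhds hp) (.and ?_ ?_))
    · exact hgc.norm.eventually (gt_mem_nhds (by nlinarith))
    · exact hgc.norm.eventually (lt_mem_nhds hc)
  obtain ⟨r, hr, hball⟩ := Metric.nhds_basis_closedBall.mem_iff.mp hev
  have hUc : ContinuousOn U (closedBall p r) := hU.continuousOn.mono fun x hx => (hball hx).2.1
  obtain ⟨hfin, hslab⟩ := hausdorffMeasure_lt_top_and_lintegral_slab_le (η := η) hν hc hκ1 hUc
    (fun x hx x' hx' => by
      have := happ x (hball hx).1 x' (hball hx').1
      rwa [hfd, Real.norm_eq_abs] at this)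
  refine ⟨r, hr, fun x hx => (hball hx).2.1, hfin, fun f hf hf0 hfc hfs τ hτ => ?_⟩
  set S := {x ∈ closedBall p r | U x = η} with hSdef
  have hSm : MeasurableSet S :=
    (hUc.preimage_isClosed_of_isClosed isClosed_closedBall
      (isClosed_singleton (x := η))).measurableSet
  have hκ : 0 < 1 - κ := by linarith
  have hd : 0 < (1 - κ) * c := mul_pos hκ hc
  set M := (μH[m] S).toReal with hM
  set ω := τ * ((1 - κ) * c) / (M + 1) with hω
  have hM0 : 0 ≤ M := ENNReal.toReal_nonneg
  have hω0 : 0 < ω := by positivity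
  obtain ⟨δ, hδ, hδf⟩ := Metric.uniformContinuous_iff.mp
    (hfc.uniformContinuous_of_continuous hf) ω hω0
  obtain ⟨ρ, hρ, hρs⟩ := hfc.isCompact.exists_cthickening_subset_open isOpen_ball hfs
  have hε₀ : 0 < min δ ρ * ((1 - κ) * c) := mul_pos (lt_min hδ hρ) hd
  filter_upwards [Ioo_mem_nhdsGT hε₀] with ε hε
  have hs : ε / ((1 - κ) * c) < min δ ρ := (div_lt_iff₀ hd).mpr hε.2
  have hs0 : 0 < ε / ((1 - κ) * c) := div_pos hε.1 hd
  refine (hslab f ε ω _ hf hε.1 rfl (fun x hx z hz => ?_) fun x x' hxx => ?_).trans ?_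
  · refine ball_subset_closedBall (hρs ?_)
    exact mem_cthickening_of_dist_le _ x ρ _ (subset_tsupport _ hx)
      ((mem_closedBall.mp hz).trans (hs.le.trans (min_le_right _ _)))
  · have := hδf (hxx.trans_lt (hs.trans_le (min_le_left _ _)))
    rw [Real.dist_eq] at this
    linarith [(abs_lt.mp this).2]
  have h1 : ∫⁻ x in S, ENNReal.ofReal (f x + ω) ∂μH[m] ≤
      ENNReal.ofReal ((1 + κ) * c) * (∫⁻ x in S, ENNReal.ofReal (f x / ‖gradient U x‖) ∂μH[m]) +
        ENNReal.ofReal ω * ENNReal.ofReal M := by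
    rw [ENNReal.ofReal_toReal hfin.ne, ← lintegral_const_mul' _ _ ENNReal.ofReal_ne_top,
      ← setLIntegral_const, ← lintegral_add_right _ measurable_const]
    refine setLIntegral_mono_ae' hSm (Eventually.of_forall fun x hx => ?_)
    have hx' := (hball hx.1).2.2
    rw [← ENNReal.ofReal_mul (by positivity),
      ← ENNReal.ofReal_add (mul_nonneg (by positivity) (div_nonneg (hf0 x) (norm_nonneg _))) hω0.le]
    refine ENNReal.ofReal_le_ofReal (add_le_add ?_ le_rfl)
    rw [← mul_div_assoc, le_div_iff₀ hx'.2, mul_comm]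
    exact mul_le_mul_of_nonneg_right hx'.1.le (hf0 x)
  refine (mul_le_mul_right h1 _).trans ?_
  rw [mul_add, mul_add]
  refine add_le_add (le_of_eq ?_) ?_
  · rw [← mul_assoc, ← mul_assoc, ← ENNReal.ofReal_mul hs0.le, ← ENNReal.ofReal_mul hε.1.le]
    congr 2
    field_simp
  · rw [← ENNReal.ofReal_mul hω0.le, ← ENNReal.ofReal_mul hs0.le, ← ENNReal.ofReal_mul hε.1.le]
    refine ENNReal.ofReal_le_ofReal ?_
    have : ε / ((1 - κ) * c) * (ω * M) = ε * τ * (M / (M + 1)) := by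
      rw [hω]; field_simp
    rw [this]
    exact mul_le_of_le_one_right (mul_pos hε.1 hτ).le ((div_le_one (by positivity)).mpr (by linarith))

lemma isCompact_sublevel_inter_Icc {n : ℕ} {W : Set (Eucl n)} {U : Eucl n → ℝ}
    (hU : ContinuousOn U W) {η₁ : ℝ} (hcpt : IsCompact {x ∈ W | U x ≤ η₁}) (a : ℝ) {b : ℝ}
    (hb : b ≤ η₁) : IsCompact {x ∈ W | a ≤ U x ∧ U x ≤ b} := by
  have hcont : ContinuousOn U {x ∈ W | U x ≤ η₁} := hU.mono fun x hx => hx.1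
  have := hcont.preimage_isClosed_of_isClosed hcpt.isClosed (isClosed_Icc (a := a) (b := b))
  convert hcpt.of_isClosed_subset this inter_subset_left using 1
  ext x
  simp only [mem_ofPred_eq, mem_inter_iff, mem_preimage, mem_Icc]
  exact ⟨fun h => ⟨⟨h.1, h.2.2.trans hb⟩, h.2⟩, fun h => ⟨h.1.1, h.2⟩⟩

/-- Thin slabs above a compact regular level set are controlled by the surface integral over the
level set, which has finite Hausdorff measure. -/
lemma hausdorffMeasure_level_lt_top_and_lintegral_slab_le {m : ℕ} {W : Set (Eucl (m + 1))}
    (hW : IsOpen W) {U : Eucl (m + 1) → ℝ} (hU : ContDiffOn ℝ 1 U W) {η η₁ : ℝ} (hη : η < η₁)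
    (hcpt : IsCompact {x ∈ W | U x ≤ η₁}) (hreg : ∀ x ∈ W, U x = η → gradient U x ≠ 0)
    {κ : ℝ} (hκ0 : 0 < κ) (hκ1 : κ < 1) :
    μH[m] {x ∈ W | U x = η} < ⊤ ∧ ∀ g : Eucl (m + 1) → ℝ, ContinuousOn g W → (∀ x ∈ W, 0 ≤ g x) →
      ∀ τ > 0, ∀ᶠ ε in 𝓝[>] (0 : ℝ),
        ∫⁻ x in {x ∈ W | η ≤ U x ∧ U x ≤ η + ε}, ENNReal.ofReal (g x) ≤
          ENNReal.ofReal ε * (ENNReal.ofReal ((1 + κ) / (1 - κ)) *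
            ∫⁻ x in {x ∈ W | U x = η}, ENNReal.ofReal (g x / ‖gradient U x‖) ∂μH[m] +
            ENNReal.ofReal τ) := by
  set S := {x ∈ W | U x = η} with hSdef
  have hclosed := fun (a : ℝ) {b : ℝ} (hb : b ≤ η₁) =>
    isCompact_sublevel_inter_Icc hU.continuousOn hcpt a hb
  have hSc : IsCompact S := by
    convert hclosed η hη.le using 1
    ext x
    simp only [hSdef, mem_ofPred_eq]
    exact ⟨fun h => ⟨h.1, h.2.ge, h.2.le⟩, fun h => ⟨h.1, le_antisymm h.2.2 h.2.1⟩⟩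
  choose! r hr hrW hfin hslab using fun p (hp : p ∈ S) =>
    exists_closedBall_lintegral_slab_le hW hU hp.1 (hreg p hp.1 hp.2) hκ0 hκ1 η
  obtain ⟨t, htS, htc⟩ := hSc.elim_nhds_subcover (fun p => ball p (r p))
    (fun p hp => ball_mem_nhds p (hr p hp))
  refine ⟨?_, fun g hg hg0 τ hτ => ?_⟩
  · have hsub : S ⊆ ⋃ p ∈ t, {x ∈ closedBall p (r p) | U x = η} := fun x hx => by
      obtain ⟨p, hp, hxp⟩ := mem_iUnion₂.mp (htc hx)
      exact mem_iUnion₂.mpr ⟨p, hp, ball_subset_closedBall hxp, hx.2⟩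
    refine (measure_mono hsub).trans_lt ?_
    exact measure_biUnion_lt_top t.finite_toSet fun p hp => hfin p (htS p hp)
  set O := ⋃ p ∈ t, ball p (r p) with hO
  have hOo : IsOpen O := isOpen_biUnion fun p _ => isOpen_ball
  obtain ⟨ε₀, hε₀, hε₀1, hslabO⟩ : ∃ ε₀ > 0, η + ε₀ ≤ η₁ ∧
      {x ∈ W | η ≤ U x ∧ U x ≤ η + ε₀} ⊆ O := by
    have hQ : IsCompact ({x ∈ W | η ≤ U x ∧ U x ≤ η₁} \ O) := (hclosed η le_rfl).diff hOo
    rcases Set.eq_empty_or_nonempty ({x ∈ W | η ≤ U x ∧ U x ≤ η₁} \ O) with h | h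
    · refine ⟨η₁ - η, by linarith, by linarith, ?_⟩
      rw [add_sub_cancel]
      exact sdiff_eq_empty.mp h
    · obtain ⟨z, hz, hzmin⟩ := hQ.exists_isMinOn h (hU.continuousOn.mono fun x hx => hx.1.1)
      have hzη : η < U z := lt_of_le_of_ne hz.1.2.1 fun h => hz.2 (htc ⟨hz.1.1, h.symm⟩)
      refine ⟨(U z - η) / 2, by linarith, by linarith [hz.1.2.2], fun x hx => ?_⟩
      by_contra hxO
      have hx' : x ∈ {x ∈ W | η ≤ U x ∧ U x ≤ η₁} \ O :=
        ⟨⟨hx.1, hx.2.1, by linarith [hx.2.2, hz.1.2.2]⟩, hxO⟩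
      have : U z ≤ U x := hzmin hx'
      linarith [hx.2.2]
  set N := t.card with hN
  let q : Fin N → Eucl (m + 1) := fun i => (t.equivFin.symm i : Eucl (m + 1))
  have hqt : ∀ i, q i ∈ t := fun i => (t.equivFin.symm i).2
  have hqS : ∀ i, q i ∈ S := fun i => htS _ (hqt i)
  have hTc : IsCompact {x ∈ W | η ≤ U x ∧ U x ≤ η + ε₀} := hclosed η hε₀1
  obtain ⟨χ, hχs, hχ1, hχI, hχc⟩ := exists_continuous_sum_one_of_isOpen_isCompact
    (s := fun i => ball (q i) (r (q i))) (fun i => isOpen_ball) hTc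
    (fun x hx => by
      obtain ⟨p, hp, hxp⟩ := mem_iUnion₂.mp (hslabO hx)
      exact mem_iUnion.mpr ⟨t.equivFin ⟨p, hp⟩, by simpa [q] using hxp⟩)
  let f : Fin N → Eucl (m + 1) → ℝ := fun i x => χ i x * g x
  have hts : ∀ i, tsupport (f i) ⊆ tsupport (χ i) := fun i => tsupport_mul_subset_left
  have htsW : ∀ i, tsupport (χ i) ⊆ W := fun i =>
    ((hχs i).trans ball_subset_closedBall).trans (hrW _ (hqS i))
  have hfcont : ∀ i, Continuous (f i) := fun i => continuous_of_tsupport fun x hx =>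
    (χ i).continuous.continuousAt.mul (hg.continuousAt (hW.mem_nhds (htsW i (hts i hx))))
  have hf0 : ∀ i x, 0 ≤ f i x := fun i x => by
    by_cases hx : x ∈ W
    · exact mul_nonneg (hχI i x).1 (hg0 x hx)
    · have : χ i x = 0 := image_eq_zero_of_notMem_tsupport fun h => hx (htsW i h)
      simp [f, this]
  have hfc : ∀ i, HasCompactSupport (f i) := fun i =>
    (hχc i).mul_right
  have hsum : ∀ x ∈ W, η ≤ U x → U x ≤ η + ε₀ → ∑ i, f i x = g x := by
    intro x hx h1 h2
    have := hχ1 ⟨hx, h1, h2⟩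
    rw [Finset.sum_apply, Pi.one_apply] at this
    rw [← Finset.sum_mul, this, one_mul]
  have hτN : 0 < τ / (N + 1) := by positivity
  have hev := eventually_all.mpr fun i => hslab (q i) (hqS i) (f i) (hfcont i) (hf0 i) (hfc i)
    ((hts i).trans (hχs i)) _ hτN
  filter_upwards [hev, Ioo_mem_nhdsGT hε₀] with ε hi hε
  have hTε : MeasurableSet {x ∈ W | η ≤ U x ∧ U x ≤ η + ε} :=
    (hclosed η (by linarith [hε.2])).measurableSet
  set C := ENNReal.ofReal ((1 + κ) / (1 - κ)) with hC
  calc ∫⁻ x in {x ∈ W | η ≤ U x ∧ U x ≤ η + ε}, ENNReal.ofReal (g x)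
      = ∫⁻ x in {x ∈ W | η ≤ U x ∧ U x ≤ η + ε}, ∑ i, ENNReal.ofReal (f i x) := by
        refine setLIntegral_congr_fun hTε fun x hx => ?_
        rw [← ENNReal.ofReal_sum_of_nonneg fun i _ => hf0 i x,
          hsum x hx.1 hx.2.1 (by linarith [hx.2.2, hε.2])]
    _ = ∑ i, ∫⁻ x in {x ∈ W | η ≤ U x ∧ U x ≤ η + ε}, ENNReal.ofReal (f i x) :=
        lintegral_finsetSum _ fun i _ => ENNReal.measurable_ofReal.comp (hfcont i).measurable
    _ ≤ ∑ i, ∫⁻ x in {x ∈ closedBall (q i) (r (q i)) | η ≤ U x ∧ U x ≤ η + ε},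
          ENNReal.ofReal (f i x) := by
        refine Finset.sum_le_sum fun i _ => ?_
        have hind : (fun x => ENNReal.ofReal (f i x)) =
            (closedBall (q i) (r (q i))).indicator fun x => ENNReal.ofReal (f i x) := by
          refine (indicator_eq_self.mpr fun x hx => ?_).symm
          refine ball_subset_closedBall (hχs i (hts i (subset_tsupport _ fun h => hx ?_)))
          simp [h]
        rw [hind, setLIntegral_indicator isClosed_closedBall.measurableSet, ← hind]
        exact lintegral_mono_set fun x hx => ⟨hx.1, hx.2.2⟩
    _ ≤ ∑ i, ENNReal.ofReal ε * (C * ∫⁻ x in {x ∈ closedBall (q i) (r (q i)) | U x = η},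
          ENNReal.ofReal (f i x / ‖gradient U x‖) ∂μH[m] + ENNReal.ofReal (τ / (N + 1))) :=
        Finset.sum_le_sum fun i _ => hi i
    _ ≤ ∑ i, ENNReal.ofReal ε * (C * ∫⁻ x in S,
          ENNReal.ofReal (f i x / ‖gradient U x‖) ∂μH[m] + ENNReal.ofReal (τ / (N + 1))) := by
        gcongr with i
        exact fun x hx => ⟨hrW _ (hqS i) hx.1, hx.2⟩
    _ = ENNReal.ofReal ε * (C * ∑ i, ∫⁻ x in S, ENNReal.ofReal (f i x / ‖gradient U x‖) ∂μH[m] +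
          N * ENNReal.ofReal (τ / (N + 1))) := by
        rw [← Finset.mul_sum, Finset.sum_add_distrib, ← Finset.mul_sum]
        simp
    _ ≤ _ := by
        gcongr
        · rw [← lintegral_finsetSum' _ fun i _ => ?_]
          · refine le_of_eq (setLIntegral_congr_fun hSc.measurableSet fun x hx => ?_)
            rw [← ENNReal.ofReal_sum_of_nonneg fun i _ => div_nonneg (hf0 i x) (norm_nonneg _),
              ← Finset.sum_div, hsum x hx.1 hx.2.ge (by linarith [hx.2])]
          · refine ENNReal.measurable_ofReal.comp_aemeasurable ?_
            refine ContinuousOn.aemeasurable ?_ hSc.measurableSet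
            exact (hfcont i).continuousOn.div
              ((continuousOn_gradient hW hU).mono fun x hx => hx.1).norm
              fun x hx => norm_ne_zero_iff.mpr (hreg x hx.1 hx.2)
        · rw [← ENNReal.ofReal_natCast, ← ENNReal.ofReal_mul (Nat.cast_nonneg _)]
          refine ENNReal.ofReal_le_ofReal ?_
          rw [mul_div_assoc', div_le_iff₀ (by positivity)]
          nlinarith

lemma Filter.EventuallyEq.Lop_eq {n : ℕ} (a : Eucl n → Matrix (Fin n) (Fin n) ℝ)
    (V : Eucl n → Fin n → ℝ) {f g : Eucl n → ℝ} {x : Eucl n} (h : f =ᶠ[𝓝 x] g) :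
    Lop a V f x = Lop a V g x := by
  have h1 : fderiv ℝ f =ᶠ[𝓝 x] fderiv ℝ g := h.fderiv
  have hp : ∀ i, pd f i x = pd g i x := fun i => by rw [pd, pd, h1.eq_of_nhds]
  have hp2 : ∀ i j, pd2 f i j x = pd2 g i j x := fun i j => by
    have : (fun y => fderiv ℝ f y (EuclideanSpace.single j 1)) =ᶠ[𝓝 x]
        fun y => fderiv ℝ g y (EuclideanSpace.single j 1) := by
      filter_upwards [h1] with y hy
      rw [hy]
    rw [pd2, pd2, this.fderiv_eq]
  simp [Lop, hp, hp2]

lemma Lop_comp {n : ℕ} (a : Eucl n → Matrix (Fin n) (Fin n) ℝ) (V : Eucl n → Fin n → ℝ)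
    {W : Set (Eucl n)} (hW : IsOpen W) {U : Eucl n → ℝ} (hU : ContDiffOn ℝ 2 U W) {φ : ℝ → ℝ}
    (hφ : ContDiff ℝ 2 φ) {x : Eucl n} (hx : x ∈ W) :
    Lop a V (φ ∘ U) x =
      deriv φ (U x) * Lop a V U x + deriv (deriv φ) (U x) * aQuad a U x := by
  have hUd : ∀ y ∈ W, DifferentiableAt ℝ U y := fun y hy =>
    (hU.contDiffAt (hW.mem_nhds hy)).differentiableAt two_ne_zero
  have hφd : Differentiable ℝ φ := hφ.differentiable two_ne_zero
  have hφ' : Differentiable ℝ (deriv φ) :=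
    ((contDiff_succ_iff_deriv (n := 1)).mp hφ).2.2.differentiable one_ne_zero
  have hpd : ∀ y ∈ W, ∀ i, pd (φ ∘ U) i y = deriv φ (U y) * pd U i y := by
    intro y hy i
    have := (hφd (U y)).hasDerivAt.comp_hasFDerivAt y (hUd y hy).hasFDerivAt
    rw [pd, this.fderiv]
    simp [pd]
  have hpd2 : ∀ i j, pd2 (φ ∘ U) i j x = deriv φ (U x) * pd2 U i j x +
      deriv (deriv φ) (U x) * (pd U i x * pd U j x) := by
    intro i j
    have he : (fun y => fderiv ℝ (φ ∘ U) y (EuclideanSpace.single j 1)) =ᶠ[𝓝 x]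
        fun y => deriv φ (U y) * pd U j y := by
      filter_upwards [hW.mem_nhds hx] with y hy using hpd y hy j
    have h1 := (hφ' (U x)).hasDerivAt.comp_hasFDerivAt x (hUd x hx).hasFDerivAt
    have h2 : DifferentiableAt ℝ (pd U j) x :=
      ((((hU.contDiffAt (hW.mem_nhds hx)).fderiv_right (m := 1) (by norm_num)).clm_apply
        contDiffAt_const).differentiableAt one_ne_zero)
    have h3 := h1.mul h2.hasFDerivAt
    have h4 : fderiv ℝ (fun y => deriv φ (U y) * pd U j y) x = _ := h3.fderiv
    rw [pd2, he.fderiv_eq, h4]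
    simp only [Function.comp_apply, add_apply, smul_apply, smul_eq_mul]
    change deriv φ (U x) * pd2 U i j x + pd U j x * (deriv (deriv φ) (U x) * pd U i x) = _
    ring
  simp only [Lop, aQuad, hpd2, hpd x hx, mul_add, Finset.mul_sum, Finset.sum_add_distrib]
  rw [add_right_comm]
  congr 1
  · congr 1
    · exact Finset.sum_congr rfl fun i _ => Finset.sum_congr rfl fun j _ => by ring
    · exact Finset.sum_congr rfl fun i _ => by ring
  · exact Finset.sum_congr rfl fun i _ => Finset.sum_congr rfl fun j _ => by ring

/-- A `C²` antiderivative of a smooth cutoff of `[ηs, η]` supported in `[ρ, η + ε]`, whose slope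
on `[η, η + ε]` is almost as small as possible. -/
lemma exists_cutoff_antiderivative {ρ ηs η ε κ : ℝ} (h1 : ρ < ηs) (h2 : ηs < η) (hε : 0 < ε)
    (hκ0 : 0 < κ) (hκ1 : κ < 1) :
    ∃ φ : ℝ → ℝ, ContDiff ℝ 2 φ ∧ (∀ t, η + ε ≤ t → φ t = 0) ∧ (∀ t, deriv φ t ≤ 0) ∧
      (∀ t ≤ ρ, deriv φ t = 0) ∧ (∀ t, ηs ≤ t → t ≤ η → deriv φ t = -1) ∧
      (∀ t, deriv (deriv φ) t ≤ 1 / ((1 - κ) * ε)) ∧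
      ∀ t, t ∉ Icc η (η + ε) → deriv (deriv φ) t ≤ 0 := by
  have hκ : 0 < 1 - κ := by linarith
  let b : ContDiffBump (η + ε / 2) :=
    ⟨(1 - κ) * ε / 2, ε / 2, by positivity, by nlinarith⟩
  set k : ℝ → ℝ := b.normed volume with hk
  have hkc : Continuous k := b.continuous_normed
  have hk0 : ∀ t, 0 ≤ k t := fun t => b.nonneg_normed t
  have hkz : ∀ t, t ∉ Ioo η (η + ε) → k t = 0 := by
    intro t ht
    by_contra hne
    have : t ∈ Function.support k := hne
    rw [hk, b.support_normed_eq, Real.ball_eq_Ioo] at this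
    have hb : b.rOut = ε / 2 := rfl
    exact ht ⟨by linarith [this.1], by linarith [this.2]⟩
  have hkle : ∀ t, k t ≤ 1 / ((1 - κ) * ε) := by
    intro t
    refine (b.normed_le_div_measure_closedBall_rIn volume t).trans_eq ?_
    have hb : b.rIn = (1 - κ) * ε / 2 := rfl
    rw [Real.volume_real_closedBall b.rIn_pos.le, hb]
    congr 1
    ring
  set K : ℝ → ℝ := fun t => ∫ x in η..t, k x with hKdef
  have hKd : ∀ t, HasDerivAt K (k t) t := fun t =>
    intervalIntegral.integral_hasDerivAt_right (hkc.intervalIntegrable _ _)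
      (hkc.stronglyMeasurableAtFilter _ _) hkc.continuousAt
  have hKmono : Monotone K := monotone_of_deriv_nonneg (fun t => (hKd t).differentiableAt)
    fun t => by rw [(hKd t).deriv]; exact hk0 t
  have hK0 : ∀ t ≤ η, K t = 0 := by
    intro t ht
    have : ∫ x in η..t, k x = ∫ _ in η..t, (0 : ℝ) := by
      refine intervalIntegral.integral_congr fun x hx => hkz x fun hx' => ?_
      rw [uIcc_of_ge ht] at hx
      exact absurd hx'.1 (not_lt.mpr hx.2)
    simpa [hKdef] using this
  have hK1 : ∀ t, η + ε ≤ t → K t = 1 := by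
    intro t ht
    rw [hKdef]
    simp only
    have h0 : ∀ x, x ∉ Ioc η t → k x = 0 := fun x hx => hkz x fun hx' =>
      hx ⟨hx'.1, hx'.2.le.trans ht⟩
    rw [intervalIntegral.integral_of_le (by linarith),
      setIntegral_eq_integral_of_forall_compl_eq_zero h0]
    exact b.integral_normed
  have hKle : ∀ t, K t ≤ 1 := fun t =>
    (hKmono (le_max_left t (η + ε))).trans_eq (hK1 _ (le_max_right _ _))
  have hd : 0 < ηs - ρ := by linarith
  set s : ℝ → ℝ := fun t => Real.smoothTransition ((t - ρ) / (ηs - ρ)) with hs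
  have hsC : ContDiff ℝ 1 s := Real.smoothTransition.contDiff.comp (by fun_prop)
  have hsm : Monotone s := fun t t' h =>
    Real.smoothTransition.monotone (div_le_div_of_nonneg_right (by linarith) hd.le)
  have hs0 : ∀ t ≤ ρ, s t = 0 := fun t ht =>
    Real.smoothTransition.zero_of_nonpos (div_nonpos_of_nonpos_of_nonneg (by linarith) hd.le)
  have hs1 : ∀ t, ηs ≤ t → s t = 1 := fun t ht =>
    Real.smoothTransition.one_of_one_le ((one_le_div hd).mpr (by linarith))
  set ψ : ℝ → ℝ := fun t => K t - s t with hψ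
  have hψd : ∀ t, HasDerivAt ψ (k t - deriv s t) t := fun t =>
    (hKd t).sub (hsC.differentiable one_ne_zero t).hasDerivAt
  have hψderiv : deriv ψ = fun t => k t - deriv s t := funext fun t => (hψd t).deriv
  have hψC : ContDiff ℝ 1 ψ := by
    rw [contDiff_one_iff_deriv]
    refine ⟨fun t => (hψd t).differentiableAt, ?_⟩
    rw [hψderiv]
    exact hkc.sub (hsC.continuous_deriv le_rfl)
  have hψ0 : ∀ t, η + ε ≤ t → ψ t = 0 := fun t ht => by
    simp [hψ, hK1 t ht, hs1 t (by linarith)]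
  have hφd : ∀ t, HasDerivAt (fun t => ∫ x in (η + ε)..t, ψ x) (ψ t) t := fun t =>
    intervalIntegral.integral_hasDerivAt_right (hψC.continuous.intervalIntegrable _ _)
      (hψC.continuous.stronglyMeasurableAtFilter _ _) hψC.continuous.continuousAt
  have hφderiv : deriv (fun t => ∫ x in (η + ε)..t, ψ x) = ψ := funext fun t => (hφd t).deriv
  refine ⟨fun t => ∫ x in (η + ε)..t, ψ x, ?_, ?_, ?_, ?_, ?_, ?_, ?_⟩
  · refine (contDiff_succ_iff_deriv (n := 1)).mpr
      ⟨fun t => (hφd t).differentiableAt, by simp, by rwa [hφderiv]⟩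
  · intro t ht
    have : ∫ x in (η + ε)..t, ψ x = ∫ _ in (η + ε)..t, (0 : ℝ) := by
      refine intervalIntegral.integral_congr fun x hx => hψ0 x ?_
      rw [uIcc_of_le ht] at hx
      exact hx.1
    simpa using this
  · intro t
    rw [hφderiv]
    rcases le_total t η with h | h
    · have : 0 ≤ s t := Real.smoothTransition.nonneg _
      simp only [hψ, hK0 t h]
      linarith
    · simp only [hψ, hs1 t (by linarith)]
      linarith [hKle t]
  · intro t ht
    rw [hφderiv]
    simp [hψ, hs0 t ht, hK0 t (by linarith)]
  · intro t ht ht'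
    rw [hφderiv]
    simp [hψ, hs1 t ht, hK0 t ht']
  · intro t
    rw [hφderiv, hψderiv]
    simp only
    linarith [hkle t, hsm.deriv_nonneg (x := t)]
  · intro t ht
    rw [hφderiv, hψderiv]
    simp only
    rw [hkz t fun h => ht (Ioo_subset_Icc_self h)]
    linarith [hsm.deriv_nonneg (x := t)]

lemma tsupport_indicator_comp_subset {n : ℕ} {W : Set (Eucl n)} {U : Eucl n → ℝ} {b : ℝ}
    (hcpt : IsCompact {x ∈ W | U x ≤ b}) {φ : ℝ → ℝ} (hφb : ∀ t, b ≤ t → φ t = 0) :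
    tsupport (W.indicator (φ ∘ U)) ⊆ {x ∈ W | U x ≤ b} := by
  refine closure_minimal (fun x hx => ?_) hcpt.isClosed
  have hxW : x ∈ W := by
    by_contra h
    exact hx (indicator_of_notMem h _)
  refine ⟨hxW, ?_⟩
  by_contra! h
  exact hx (by rw [indicator_of_mem hxW, Function.comp_apply, hφb _ h.le])

lemma contDiff_indicator_comp {n : ℕ} {W : Set (Eucl n)} (hW : IsOpen W) {U : Eucl n → ℝ}
    (hU : ContDiffOn ℝ 2 U W) {b : ℝ} (hcpt : IsCompact {x ∈ W | U x ≤ b}) {φ : ℝ → ℝ}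
    (hφ : ContDiff ℝ 2 φ) (hφb : ∀ t, b ≤ t → φ t = 0) :
    ContDiff ℝ 2 (W.indicator (φ ∘ U)) := by
  refine contDiff_iff_contDiffAt.mpr fun x => ?_
  by_cases hx : x ∈ tsupport (W.indicator (φ ∘ U))
  swap
  · exact contDiffAt_const.congr_of_eventuallyEq (notMem_tsupport_iff_eventuallyEq.mp hx)
  have hxW : W ∈ 𝓝 x := hW.mem_nhds (tsupport_indicator_comp_subset hcpt hφb hx).1
  refine (hφ.contDiffAt.comp x (hU.contDiffAt hxW)).congr_of_eventuallyEq ?_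
  filter_upwards [hxW] with y hy using indicator_of_mem hy _

/-- Testing stationarity against `φ ∘ U` with `φ` a cutoff antiderivative bounds the mass between
two levels by the average of `u ⟨a∇U, ∇U⟩` over a thin slab above the upper level. -/
lemma mul_setIntegral_le_setIntegral_slab {n : ℕ} {W : Set (Eucl n)} (hW : IsOpen W)
    {a : Eucl n → Matrix (Fin n) (Fin n) ℝ} (ha : ∀ i j, ContinuousOn (fun x => a x i j) W)
    (ha_psd : ∀ x ∈ W, ∀ v : Fin n → ℝ, 0 ≤ ∑ i, ∑ j, a x i j * v i * v j)
    {V : Eucl n → Fin n → ℝ} (hV : ContinuousOn V W)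
    {u : Eucl n → ℝ} (hu : ContinuousOn u W) (hu0 : ∀ x ∈ W, 0 ≤ u x)
    (hu_stat : ∀ f : Eucl n → ℝ, ContDiff ℝ (⊤ : ℕ∞) f → HasCompactSupport f →
      tsupport f ⊆ W → (∫ x in W, Lop a V f x * u x) = 0)
    {U : Eucl n → ℝ} (hU : ContDiffOn ℝ 2 U W) {ρ γ : ℝ} (hγ : 0 < γ)
    (hAnti : ∀ x ∈ W, x ∉ closure {y ∈ W | U y < ρ} → γ ≤ Lop a V U x)
    {ηs η ε κ : ℝ} (h1 : ρ < ηs) (h2 : ηs < η) (hε : 0 < ε) (hκ0 : 0 < κ) (hκ1 : κ < 1)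
    (hcpt : IsCompact {x ∈ W | U x ≤ η + ε})
    (hg : ContinuousOn (fun x => aQuad a U x * u x) W) :
    γ * ∫ x in {x ∈ W | ηs ≤ U x ∧ U x < η}, u x ≤
      1 / ((1 - κ) * ε) * ∫ x in {x ∈ W | η ≤ U x ∧ U x ≤ η + ε}, aQuad a U x * u x := by
  obtain ⟨φ, hφ, hφb, hφ1, hφρ, hφT, hφ2, hφ2'⟩ :=
    exists_cutoff_antiderivative h1 h2 hε hκ0 hκ1
  set K := {x ∈ W | U x ≤ η + ε} with hK
  set T := {x ∈ W | ηs ≤ U x ∧ U x < η} with hT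
  set Q := {x ∈ W | η ≤ U x ∧ U x ≤ η + ε} with hQ
  set c := 1 / ((1 - κ) * ε)
  have hKW : K ⊆ W := fun x hx => hx.1
  have hQc : IsCompact Q := isCompact_sublevel_inter_Icc hU.continuousOn hcpt η le_rfl
  have hQK : Q ⊆ K := fun x hx => ⟨hx.1, hx.2.2⟩
  have hTK : T ⊆ K := fun x hx => ⟨hx.1, by linarith [hx.2.2]⟩
  have hTm : MeasurableSet T := by
    have e : T = {x ∈ W | ηs ≤ U x ∧ U x ≤ η + ε} \ Q := by
      ext x
      constructor
      · rintro ⟨hx, h, h'⟩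
        exact ⟨⟨hx, h, by linarith⟩, fun h'' => h'.not_ge h''.2.1⟩
      · rintro ⟨⟨hx, h, h'⟩, h''⟩
        exact ⟨hx, h, not_le.mp fun hle => h'' ⟨hx, hle, h'⟩⟩
    rw [e]
    exact (isCompact_sublevel_inter_Icc hU.continuousOn hcpt ηs le_rfl).measurableSet.diff
      hQc.measurableSet
  set f := W.indicator (φ ∘ U) with hf
  have hfC : ContDiff ℝ 2 f := contDiff_indicator_comp hW hU hcpt hφ hφb
  have hfK : tsupport f ⊆ K := tsupport_indicator_comp_subset hcpt hφb
  have hfc : HasCompactSupport f := hcpt.of_isClosed_subset (isClosed_tsupport f) hfK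
  have hzero : ∫ x in K, Lop a V f x * u x = 0 := by
    rw [← integral_Lop_mul_eq_zero_of_contDiff_two hW ha hV hu hu_stat hfC hfc (hfK.trans hKW)]
    refine (setIntegral_eq_of_subset_of_forall_sdiff_eq_zero hW.measurableSet hKW
      fun x hx => ?_).symm
    rw [Lop_eq_zero_of_notMem_tsupport a V (fun h => hx.2 (hfK h)), zero_mul]
  have hLi : IntegrableOn (fun x => Lop a V f x * u x) K :=
    ((continuousOn_Lop_mul ha hV hu hfC).mono hKW).integrableOn_compact hcpt
  have hgi : IntegrableOn (Q.indicator fun x => aQuad a U x * u x) K :=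
    ((hg.mono hKW).integrableOn_compact hcpt).indicator hQc.measurableSet
  have hui : IntegrableOn (T.indicator u) K :=
    ((hu.mono hKW).integrableOn_compact hcpt).indicator hTm
  have hpt : ∀ x ∈ K, γ * T.indicator u x ≤
      c * Q.indicator (fun x => aQuad a U x * u x) x - Lop a V f x * u x := by
    intro x hx
    have hLf : Lop a V f x =
        deriv φ (U x) * Lop a V U x + deriv (deriv φ) (U x) * aQuad a U x := by
      rw [← Lop_comp a V hW hU hφ hx.1]
      refine Filter.EventuallyEq.Lop_eq a V ?_
      filter_upwards [hW.mem_nhds hx.1] with y hy using indicator_of_mem hy _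
    have hA : 0 ≤ aQuad a U x := ha_psd x hx.1 fun i => pd U i x
    have hu0x := hu0 x hx.1
    have hLU : deriv φ (U x) * Lop a V U x ≤ deriv φ (U x) * γ := by
      rcases le_or_gt (U x) ρ with h | h
      · simp [hφρ _ h]
      · refine mul_le_mul_of_nonpos_left (hAnti x hx.1 ?_) (hφ1 _)
        have ho : IsOpen (W ∩ U ⁻¹' Ioi ρ) := hU.continuousOn.isOpen_inter_preimage hW isOpen_Ioi
        intro hcl
        obtain ⟨y, hy, hy'⟩ := mem_closure_iff.mp hcl _ ho ⟨hx.1, h⟩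
        exact lt_asymm hy.2 hy'.2
    have hT' : γ * T.indicator u x ≤ -(deriv φ (U x) * Lop a V U x) * u x := by
      by_cases hxT : x ∈ T
      · rw [indicator_of_mem hxT]
        rw [hφT _ hxT.2.1 hxT.2.2.le] at hLU ⊢
        nlinarith
      · rw [indicator_of_notMem hxT, mul_zero]
        refine mul_nonneg ?_ hu0x
        nlinarith [hφ1 (U x)]
    have hQ' : deriv (deriv φ) (U x) * (aQuad a U x * u x) ≤
        c * Q.indicator (fun x => aQuad a U x * u x) x := by
      by_cases hxQ : x ∈ Q
      · rw [indicator_of_mem hxQ]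
        exact mul_le_mul_of_nonneg_right (hφ2 _) (mul_nonneg hA hu0x)
      · rw [indicator_of_notMem hxQ, mul_zero]
        exact mul_nonpos_of_nonpos_of_nonneg
          (hφ2' _ fun h => hxQ ⟨hx.1, h.1, h.2⟩) (mul_nonneg hA hu0x)
    rw [hLf]
    linarith
  have hmono := setIntegral_mono_on (hui.const_mul γ) ((hgi.const_mul c).sub hLi)
    hcpt.measurableSet hpt
  rw [integral_sub' (hgi.const_mul c) hLi, hzero, sub_zero, integral_const_mul,
    integral_const_mul, setIntegral_indicator hTm, setIntegral_indicator hQc.measurableSet,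
    inter_eq_right.mpr hTK, inter_eq_right.mpr hQK] at hmono
  exact hmono

/-- Inequality (p12) in the proof of Theorem B(a). -/
theorem inequality_p12
    {n : ℕ} (hn : 0 < n)
    (𝒰 : Set (Eucl n)) (hUopen : IsOpen 𝒰) (hUconn : IsConnected 𝒰)
    (a : Eucl n → Matrix (Fin n) (Fin n) ℝ)
    (ha_C1 : ∀ i j, ContDiffOn ℝ 1 (fun x => a x i j) 𝒰)
    (ha_symm : ∀ x ∈ 𝒰, ∀ i j, a x i j = a x j i)
    (ha_psd : ∀ x ∈ 𝒰, ∀ v : Fin n → ℝ, 0 ≤ ∑ i, ∑ j, a x i j * v i * v j)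
    (V : Eucl n → Fin n → ℝ) (hV_cont : ContinuousOn V 𝒰)
    (u : Eucl n → ℝ) (hu_C1 : ContDiffOn ℝ 1 u 𝒰) (hu_nonneg : ∀ x ∈ 𝒰, 0 ≤ u x)
    (hu_mass : (∫ x in 𝒰, u x) = 1)
    (hu_stat : ∀ f : Eucl n → ℝ, ContDiff ℝ (⊤ : ℕ∞) f → HasCompactSupport f →
      tsupport f ⊆ 𝒰 → (∫ x in 𝒰, Lop a V f x * u x) = 0)
    (U : Eucl n → ℝ) (ρM : EReal) (hU_C2 : ContDiffOn ℝ 2 U 𝒰)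
    (hU_nonneg : ∀ x ∈ 𝒰, 0 ≤ U x)
    (hU_lt : ∀ x ∈ 𝒰, (U x : EReal) < ρM)
    (hU_sup : ρM = ⨆ x : 𝒰, (U x.1 : EReal))
    (hU_cpt : ∀ ρ : ℝ, (ρ : EReal) < ρM → IsCompact {x ∈ 𝒰 | U x ≤ ρ})
    (ρm γ : ℝ) (hρm_pos : 0 < ρm) (hρm_lt : (ρm : EReal) < ρM) (hγ : 0 < γ)
    (hAnti : ∀ x ∈ 𝒰, x ∉ closure {y ∈ 𝒰 | U y < ρm} → γ ≤ Lop a V U x)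
    (H : ℝ → ℝ) (hH_meas : Measurable H)
    (hH_nonneg : ∀ t : ℝ, 0 ≤ t → (t : EReal) < ρM → 0 ≤ H t)
    (hH_locbdd : ∀ ρ : ℝ, (ρ : EReal) < ρM → BddAbove (H '' Set.Icc 0 ρ))
    (hH_up : ∀ x ∈ 𝒰, aQuad a U x ≤ H (U x))
    (ηs η : ℝ) (hη1 : ρm < ηs) (hη2 : ηs < η) (hη3 : (η : EReal) < ρM)
    (hreg : ∀ x ∈ 𝒰, (U x = η ∨ U x = ηs) → gradient U x ≠ 0) :
    γ * (∫ x in {x ∈ 𝒰 | ηs ≤ U x ∧ U x < η}, u x) ≤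
      H η * ∫ x in {x ∈ 𝒰 | U x = η}, u x / ‖gradient U x‖ ∂μH[(n : ℝ) - 1] := by
  obtain ⟨m, rfl⟩ : ∃ m, n = m + 1 := ⟨n - 1, by omega⟩
  have hdim : ((m + 1 : ℕ) : ℝ) - 1 = m := by push_cast; ring
  rw [hdim]
  obtain ⟨η₁, hη₁, hη₁M⟩ := EReal.lt_iff_exists_real_btwn.mp hη3
  replace hη₁ : η < η₁ := EReal.coe_lt_coe_iff.mp hη₁
  have hcpt := hU_cpt η₁ hη₁M
  have hu := hu_C1.continuousOn
  have ha : ∀ i j, ContinuousOn (fun x => a x i j) 𝒰 := fun i j => (ha_C1 i j).continuousOn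
  have hU1 : ContDiffOn ℝ 1 U 𝒰 := hU_C2.of_le (by norm_num)
  have hpd : ∀ i, ContinuousOn (pd U i) 𝒰 := fun i =>
    (hU1.continuousOn_fderiv_of_isOpen hUopen le_rfl).clm_apply continuousOn_const
  have hg : ContinuousOn (fun x => aQuad a U x * u x) 𝒰 :=
    (continuousOn_finsetSum _ fun i _ => continuousOn_finsetSum _ fun j _ =>
      ((ha i j).mul (hpd i)).mul (hpd j)).mul hu
  have hg0 : ∀ x ∈ 𝒰, 0 ≤ aQuad a U x * u x := fun x hx =>
    mul_nonneg (ha_psd x hx fun i => pd U i x) (hu_nonneg x hx)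
  have hregη : ∀ x ∈ 𝒰, U x = η → gradient U x ≠ 0 := fun x hx h => hreg x hx (Or.inl h)
  have hHη : 0 ≤ H η := hH_nonneg η (by linarith) hη3
  set S := {x ∈ 𝒰 | U x = η} with hS
  have hSc : IsCompact S := by
    convert isCompact_sublevel_inter_Icc hU1.continuousOn hcpt η hη₁.le using 1
    ext x
    simp only [hS, mem_ofPred_eq]
    exact ⟨fun h => ⟨h.1, h.2.ge, h.2.le⟩, fun h => ⟨h.1, le_antisymm h.2.2 h.2.1⟩⟩
  have hSfin : μH[(m : ℝ)] S < ⊤ := (hausdorffMeasure_level_lt_top_and_lintegral_slab_le hUopen hU1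
    hη₁ hcpt hregη one_half_pos one_half_lt_one).1
  have hJc : ContinuousOn (fun x => u x / ‖gradient U x‖) S :=
    (hu.mono fun x hx => hx.1).div
      ((continuousOn_gradient hUopen hU1).mono fun x hx => hx.1).norm
      fun x hx => norm_ne_zero_iff.mpr (hregη x hx.1 hx.2)
  have hJi : IntegrableOn (fun x => u x / ‖gradient U x‖) S μH[(m : ℝ)] := by
    obtain ⟨C, hC⟩ := hSc.exists_bound_of_continuousOn hJc
    exact IntegrableOn.of_bound hSfin (hJc.aestronglyMeasurable hSc.measurableSet) C
      (ae_restrict_of_forall_mem hSc.measurableSet hC)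
  have hJ0 : ∀ x ∈ S, 0 ≤ u x / ‖gradient U x‖ := fun x hx =>
    div_nonneg (hu_nonneg x hx.1) (norm_nonneg _)
  set J := ∫ x in S, u x / ‖gradient U x‖ ∂μH[(m : ℝ)] with hJ
  have hJ' : ∫⁻ x in S, ENNReal.ofReal (aQuad a U x * u x / ‖gradient U x‖) ∂μH[(m : ℝ)] ≤
      ENNReal.ofReal (H η * J) := by
    rw [ENNReal.ofReal_mul hHη, hJ, ofReal_integral_eq_lintegral_ofReal hJi
      (ae_restrict_of_forall_mem hSc.measurableSet hJ0),
      ← lintegral_const_mul' _ _ ENNReal.ofReal_ne_top]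
    refine setLIntegral_mono_ae' hSc.measurableSet (Eventually.of_forall fun x hx => ?_)
    rw [← ENNReal.ofReal_mul hHη, mul_div_assoc, ← hx.2]
    exact ENNReal.ofReal_le_ofReal (mul_le_mul_of_nonneg_right (hH_up x hx.1) (hJ0 x hx))
  have hJn : 0 ≤ J := setIntegral_nonneg hSc.measurableSet hJ0
  have key : ∀ κ ∈ Ioo (0 : ℝ) 1, γ * (∫ x in {x ∈ 𝒰 | ηs ≤ U x ∧ U x < η}, u x) ≤
      1 / (1 - κ) * ((1 + κ) / (1 - κ) * (H η * J) + κ) := by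
    rintro κ ⟨hκ0, hκ1⟩
    have hκ : 0 < 1 - κ := by linarith
    have hslab := (hausdorffMeasure_level_lt_top_and_lintegral_slab_le hUopen hU1 hη₁ hcpt hregη
      hκ0 hκ1).2 _ hg hg0 κ hκ0
    obtain ⟨ε, hε, hε0, hε1⟩ := (hslab.and (Ioo_mem_nhdsGT (sub_pos.mpr hη₁))).exists
    have hle : η + ε ≤ η₁ := by linarith
    have hQc := isCompact_sublevel_inter_Icc hU1.continuousOn hcpt η hle
    have hb : 0 ≤ (1 + κ) / (1 - κ) * (H η * J) := by positivity
    have hQ : ∫ x in {x ∈ 𝒰 | η ≤ U x ∧ U x ≤ η + ε}, aQuad a U x * u x ≤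
        ε * ((1 + κ) / (1 - κ) * (H η * J) + κ) := by
      rw [integral_eq_lintegral_of_nonneg_ae
        (ae_restrict_of_forall_mem hQc.measurableSet fun x hx => hg0 x hx.1)
        ((hg.mono fun x hx => hx.1).aestronglyMeasurable hQc.measurableSet)]
      refine ENNReal.toReal_le_of_le_ofReal (by positivity) (hε.trans ?_)
      rw [ENNReal.ofReal_mul hε0.le, ENNReal.ofReal_add hb hκ0.le,
        ENNReal.ofReal_mul (by positivity)]
      gcongr
    have hcε : IsCompact {x ∈ 𝒰 | U x ≤ η + ε} :=
      hU_cpt _ ((EReal.coe_le_coe_iff.mpr hle).trans_lt hη₁M)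
    refine (mul_setIntegral_le_setIntegral_slab hUopen ha ha_psd hV_cont hu hu_nonneg hu_stat hU_C2
      hγ hAnti hη1 hη2 hε0 hκ0 hκ1 hcε hg).trans ?_
    refine (mul_le_mul_of_nonneg_left hQ (by positivity)).trans_eq ?_
    field_simp
  have hlim : Tendsto (fun κ : ℝ => 1 / (1 - κ) * ((1 + κ) / (1 - κ) * (H η * J) + κ)) (𝓝[>] 0)
      (𝓝 (H η * J)) := by
    have hc : ContinuousAt
        (fun κ : ℝ => 1 / (1 - κ) * ((1 + κ) / (1 - κ) * (H η * J) + κ)) 0 := by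
      fun_prop (disch := norm_num)
    have := hc.tendsto
    simp only [sub_zero, add_zero, div_one, one_mul] at this
    exact this.mono_left nhdsWithin_le_nhds
  exact ge_of_tendsto hlim (mem_of_superset (Ioo_mem_nhdsGT one_pos) key)
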